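/- On ℂ[u, v, w] define the bracket with structure functions {u, v} = −8w, {u, w} = −12v², {v, w} = −1728u³, i.e. {f, g} := (−8w)(f_u g_v − f_v g_u) + (−12v²)(f_u g_w − f_w g_u) + (−1728u³)(f_v g_w − f_w g_v). Then: (a) this bracket satisfies the Jacobi identity; and (b) the ℂ-algebra homomorphism F : ℂ[u, v, w] → ℂ[x, y] determined by u ↦ x⁵y − xy⁵, v ↦ x⁸ + 14x⁴y⁴ + y⁸, w ↦ x¹² − 33x⁸y⁴ − 33x⁴y⁸ + y¹² intertwines brackets: F({f, g}) = {F f, F g}_std. (This realizes the E₆ Kleinian singularity ℂ²/BT₂₄, where BT₂₄ is the binary tetrahedral group, as a Poisson subvariety of ℂ³.) -/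

import Mathlib

open MvPolynomial

/-- The bracket on ℂ[u, v, w] with structure functions `{u,v} = −8w`, `{u,w} = −12v²`,
`{v,w} = −1728u³` (variables `0 ↦ u, 1 ↦ v, 2 ↦ w`). -/
noncomputable def e6Br (f g : MvPolynomial (Fin 3) ℂ) : MvPolynomial (Fin 3) ℂ :=
  (C (-8 : ℂ) * X 2) * (pderiv 0 f * pderiv 1 g - pderiv 1 f * pderiv 0 g) +
  (C (-12 : ℂ) * X 1 ^ 2) * (pderiv 0 f * pderiv 2 g - pderiv 2 f * pderiv 0 g) +
  (C (-1728 : ℂ) * X 0 ^ 3) * (pderiv 1 f * pderiv 2 g - pderiv 2 f * pderiv 1 g)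

/-- The standard symplectic bracket `{p, q} = p_x q_y − p_y q_x` on ℂ[x, y]. -/
noncomputable def stdBr (p q : MvPolynomial (Fin 2) ℂ) : MvPolynomial (Fin 2) ℂ :=
  pderiv 0 p * pderiv 1 q - pderiv 1 p * pderiv 0 q

/-- The Hilbert-map pullback `u ↦ x⁵y − xy⁵, v ↦ x⁸ + 14x⁴y⁴ + y⁸,
w ↦ x¹² − 33x⁸y⁴ − 33x⁴y⁸ + y¹²`. -/
noncomputable def e6Hilbert : MvPolynomial (Fin 3) ℂ →ₐ[ℂ] MvPolynomial (Fin 2) ℂ :=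
  aeval ![X 0 ^ 5 * X 1 - X 0 * X 1 ^ 5,
    X 0 ^ 8 + C (14 : ℂ) * X 0 ^ 4 * X 1 ^ 4 + X 1 ^ 8,
    X 0 ^ 12 - C (33 : ℂ) * X 0 ^ 8 * X 1 ^ 4 - C (33 : ℂ) * X 0 ^ 4 * X 1 ^ 8 + X 1 ^ 12]

namespace MvPolynomial

variable {R σ τ : Type*} [CommRing R]

/-- Partial derivatives commute. -/
theorem pderiv_pderiv_comm (i j : σ) (f : MvPolynomial σ R) :
    pderiv i (pderiv j f) = pderiv j (pderiv i f) := by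
  classical
  have h : ⁅pderiv (R := R) i, pderiv (R := R) j⁆ = 0 := by
    refine derivation_ext fun k => ?_
    rw [Derivation.commutator_apply, pderiv_X, pderiv_X, Pi.single_apply, Pi.single_apply]
    split_ifs <;> simp
  have hf := congrArg (fun D => D f) h
  simpa [Derivation.commutator_apply, sub_eq_zero] using hf

/-- The chain rule for a polynomial substitution. -/
theorem pderiv_aeval_eq_sum [Fintype σ] (p : σ → MvPolynomial τ R) (i : τ)
    (f : MvPolynomial σ R) :
    pderiv i (aeval p f) = ∑ j, aeval p (pderiv j f) * pderiv i (p j) := by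
  classical
  induction f using MvPolynomial.induction_on with
  | C a => simp [algebraMap_eq]
  | add f g hf hg => simp only [map_add, hf, hg, add_mul, Finset.sum_add_distrib]
  | mul_X f k hf =>
    simp only [map_mul, aeval_X, Derivation.leibniz, smul_eq_mul, hf, map_add, add_mul,
      Finset.sum_add_distrib, Finset.mul_sum]
    congr 1
    · simp [pderiv_X, Pi.single_apply]
    · exact Finset.sum_congr rfl fun j _ => by ring

end MvPolynomial

/-- The bracket `e6Br` satisfies the Jacobi identity. -/
theorem e6Br_jacobi (f g h : MvPolynomial (Fin 3) ℂ) :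
    e6Br f (e6Br g h) + e6Br g (e6Br h f) + e6Br h (e6Br f g) = 0 := by
  simp only [e6Br, map_add, map_sub, Derivation.leibniz, Derivation.leibniz_pow, pderiv_C,
    pderiv_X, smul_eq_mul, nsmul_eq_mul, Pi.single_apply, Fin.reduceEq, if_true, if_false,
    pderiv_pderiv_comm (1 : Fin 3) 0, pderiv_pderiv_comm (2 : Fin 3) 0,
    pderiv_pderiv_comm (2 : Fin 3) 1]
  ring

/-- The Hilbert map intertwines `e6Br` with the standard symplectic bracket. -/
theorem e6Hilbert_e6Br (f g : MvPolynomial (Fin 3) ℂ) :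
    e6Hilbert (e6Br f g) = stdBr (e6Hilbert f) (e6Hilbert g) := by
  have hC (n : ℕ) [n.AtLeastTwo] :
      (C (OfNat.ofNat n : ℂ) : MvPolynomial (Fin 2) ℂ) = OfNat.ofNat n := map_ofNat C n
  simp only [e6Br, stdBr, e6Hilbert, pderiv_aeval_eq_sum, Fin.sum_univ_three]
  simp only [map_add, map_sub, map_mul, map_pow, map_neg, aeval_C, aeval_X, algebraMap_eq,
    Matrix.cons_val, Derivation.leibniz, Derivation.leibniz_pow, pderiv_C, pderiv_X,
    smul_eq_mul, nsmul_eq_mul, Pi.single_apply, Fin.reduceEq, if_true, if_false]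
  simp only [hC]
  push_cast
  ring

/-- (a) The bracket `e6Br` satisfies the Jacobi identity, and (b) the Hilbert map intertwines
it with the standard symplectic bracket: this realizes the `E₆` Kleinian singularity
ℂ²/BT₂₄ as a Poisson subvariety of ℂ³. -/
theorem E6_singularity_poisson_embedding :
    (∀ f g h : MvPolynomial (Fin 3) ℂ,
      e6Br f (e6Br g h) + e6Br g (e6Br h f) + e6Br h (e6Br f g) = 0) ∧
    (∀ f g : MvPolynomial (Fin 3) ℂ,
      e6Hilbert (e6Br f g) = stdBr (e6Hilbert f) (e6Hilbert g)) :=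
  ⟨e6Br_jacobi, e6Hilbert_e6Br⟩
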